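/- Let (x,y,z,w) ∈ ℂ⁴ be a nonzero point satisfying w² = x²y² − z⁴, and suppose there exists λ ∈ ℂˣ with (x, −y, −z, −w) = (λx, λy, λz, λ²w). Then either y = z = w = 0, or x = z = w = 0. Consequently, the involution σ[x:y:z:w] = [x:−y:−z:−w] of the surface {w² = x²y² − z⁴} in the weighted projective space P(1,1,1,2) has exactly two fixed points, [1:0:0:0] and [0:1:0:0]. -/

import Mathlib

/-- Let `(x,y,z,w) ∈ ℂ⁴` be a nonzero point with `w² = x²y² − z⁴` (the affine cone over
the surface `X₂^{γ₀} ⊂ P(1,1,1,2)`), and suppose `(x, −y, −z, −w) = (λx, λy, λz, λ²w)`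
for some `λ ∈ ℂˣ` (i.e. the point is fixed by the involution
`σ[x:y:z:w] = [x:−y:−z:−w]`).  Then `y = z = w = 0` or `x = z = w = 0`; that is, `σ`
has exactly the two fixed points `[1:0:0:0]` and `[0:1:0:0]`. -/
theorem stmt_17 (x y z w : ℂ) (hne : (x, y, z, w) ≠ (0, 0, 0, 0))
    (hsurf : w ^ 2 = x ^ 2 * y ^ 2 - z ^ 4)
    (hfix : ∃ l : ℂˣ,
      ((x, -y, -z, -w) : ℂ × ℂ × ℂ × ℂ)
        = ((l : ℂ) * x, (l : ℂ) * y, (l : ℂ) * z, (l : ℂ) ^ 2 * w)) :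
    (y = 0 ∧ z = 0 ∧ w = 0) ∨ (x = 0 ∧ z = 0 ∧ w = 0) := by
  obtain ⟨l, hl⟩ := hfix
  simp only [Prod.mk.injEq] at hl
  obtain ⟨hx, hy, hz, hw⟩ := hl
  by_cases x0 : x = 0
  · right
    have w0 : w = 0 := by
      by_cases z0 : z = 0
      · simpa [x0, z0] using hsurf
      · have hl : (l : ℂ) = -1 := mul_right_cancel₀ z0 (by linear_combination -hz)
        rw [hl] at hw
        linear_combination (-1 / 2) * hw
    have z0 : z = 0 := by simpa [x0, w0] using hsurf
    exact ⟨x0, z0, w0⟩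
  · left
    have hl : (l : ℂ) = 1 := mul_right_cancel₀ x0 (by linear_combination -hx)
    rw [hl] at hy hz hw
    exact ⟨by linear_combination (-1 / 2) * hy, by linear_combination (-1 / 2) * hz,
      by linear_combination (-1 / 2) * hw⟩
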